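/- arXiv:0709.4239 — 4 statements merged into one kernel-verified Lean document; each statement's English description precedes it below -/
import Mathlib

section
/- Let (M, d) be a metric space, let a ≤ b and α ≤ β be real numbers, let p : [a, b] → M be continuous, and let φ : [α, β] → [a, b] be a continuous map of [α, β] onto [a, b] (not necessarily monotone). If p ∘ φ has finite length, then p has finite length, and the length of p is less than or equal to the length of p ∘ φ. -/
/-- The set of approximations `Λ_P = ∑ d(p(t_j), p(t_{j-1}))` to the length of
the path `p` on `[a, b]`, over all partitions `a = t₀ < t₁ < ⋯ < tₙ = b`. -/
def pathSums {M : Type*} [MetricSpace M] (p : ℝ → M) (a b : ℝ) : Set ℝ :=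
  {L | ∃ (n : ℕ) (t : ℕ → ℝ), t 0 = a ∧ t n = b ∧ (∀ i < n, t i < t (i + 1)) ∧
        L = ∑ i ∈ Finset.range n, dist (p (t i)) (p (t (i + 1)))}

/-- A path has finite length if its approximations `Λ_P` are bounded above. -/
def HasFiniteLength {M : Type*} [MetricSpace M] (p : ℝ → M) (a b : ℝ) : Prop :=
  BddAbove (pathSums p a b)

/-- The length of a path: the supremum of the approximations `Λ_P`. -/
noncomputable def pathLength {M : Type*} [MetricSpace M] (p : ℝ → M) (a b : ℝ) : ℝ :=
  sSup (pathSums p a b)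

/-- Extending a partition by one (possibly degenerate) step. -/
theorem pathSums_append {M : Type*} [MetricSpace M] {f : ℝ → M} {x y z L : ℝ}
    (hL : L ∈ pathSums f x y) (hyz : y ≤ z) : L + dist (f y) (f z) ∈ pathSums f x z := by
  rcases hyz.eq_or_lt with rfl | hyz
  · simpa using hL
  obtain ⟨n, t, h0, hn, ht, rfl⟩ := hL
  refine ⟨n + 1, fun i => if i ≤ n then t i else z, by simpa using h0, by simp, ?_, ?_⟩
  · intro i hi
    rcases (Nat.lt_succ_iff.mp hi).eq_or_lt with rfl | hi
    · simpa [hn] using hyz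
    · simpa [hi.le, Nat.succ_le_of_lt hi] using ht i hi
  · rw [Finset.sum_range_succ]
    congr 1
    · refine Finset.sum_congr rfl fun i hi => ?_
      have hi := Finset.mem_range.mp hi
      simp [hi.le, Nat.succ_le_of_lt hi]
    · simp [hn]

/-- Sums along weakly increasing sequences are already partition sums. -/
theorem sum_dist_mem_pathSums {M : Type*} [MetricSpace M] (f : ℝ → M) (s : ℕ → ℝ) (n : ℕ)
    (hs : ∀ i < n, s i ≤ s (i + 1)) :
    ∑ i ∈ Finset.range n, dist (f (s i)) (f (s (i + 1))) ∈ pathSums f (s 0) (s n) := by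
  induction n with
  | zero => exact ⟨0, s, rfl, rfl, by simp, rfl⟩
  | succ n ih =>
    rw [Finset.sum_range_succ]
    exact pathSums_append (ih fun i hi => hs i (by lia)) (hs n (by lia))

theorem pathSums_nonempty {M : Type*} [MetricSpace M] (f : ℝ → M) {a b : ℝ} (hab : a ≤ b) :
    (pathSums f a b).Nonempty :=
  ⟨_, pathSums_append ⟨0, fun _ => a, rfl, rfl, by simp, rfl⟩ hab⟩

/-- Sums along weakly increasing sequences in `[α, β]` are dominated by partition sums. -/
theorem exists_sum_dist_le_mem_pathSums {M : Type*} [MetricSpace M] (f : ℝ → M) {α β : ℝ}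
    (s : ℕ → ℝ) (n : ℕ) (hs : ∀ i < n, s i ≤ s (i + 1)) (hα : α ≤ s 0) (hβ : s n ≤ β) :
    ∃ L ∈ pathSums f α β, ∑ i ∈ Finset.range n, dist (f (s i)) (f (s (i + 1))) ≤ L := by
  have h := sum_dist_mem_pathSums f (fun i => Nat.casesOn i α s) (n + 1) (by
    rintro (_ | i) hi
    · exact hα
    · exact hs i (by lia))
  refine ⟨_, pathSums_append h hβ, ?_⟩
  rw [Finset.sum_range_succ', add_assoc]
  exact le_add_of_nonneg_right (by positivity)

/-- A continuous function on `[u, v]` has a monotone right inverse on `[φ u, φ v]`. -/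
theorem exists_monotoneOn_rightInverse {φ : ℝ → ℝ} {u v : ℝ} (huv : u ≤ v)
    (hφ : ContinuousOn φ (Set.Icc u v)) :
    ∃ g : ℝ → ℝ, MonotoneOn g (Set.Icc (φ u) (φ v)) ∧
      ∀ t ∈ Set.Icc (φ u) (φ v), g t ∈ Set.Icc u v ∧ φ (g t) = t := by
  let S : ℝ → Set ℝ := fun t => Set.Icc u v ∩ φ ⁻¹' Set.Ici t
  have hbdd : ∀ t, BddBelow (S t) := fun t => ⟨u, fun s hs => hs.1.1⟩
  have hne : ∀ t ∈ Set.Icc (φ u) (φ v), (S t).Nonempty :=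
    fun t ht => ⟨v, Set.right_mem_Icc.mpr huv, ht.2⟩
  refine ⟨fun t => sInf (S t), fun t _ t' ht' htt' => ?_, fun t ht => ?_⟩
  · exact csInf_le_csInf (hbdd t) (hne t' ht') fun s hs => ⟨hs.1, htt'.trans hs.2⟩
  · have hmem : sInf (S t) ∈ S t :=
      (hφ.preimage_isClosed_of_isClosed isClosed_Icc isClosed_Ici).csInf_mem (hne t ht) (hbdd t)
    refine ⟨hmem.1, ?_⟩
    obtain ⟨s, hs, rfl⟩ := intermediate_value_Icc hmem.1.1
      (hφ.mono (Set.Icc_subset_Icc_right hmem.1.2)) ⟨ht.1, hmem.2⟩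
    have hle : sInf (S (φ s)) ≤ s :=
      csInf_le (hbdd _) ⟨⟨hs.1, hs.2.trans hmem.1.2⟩, le_refl (φ s)⟩
    exact congrArg φ (hle.antisymm hs.2)

/-- Partition sums of `p` on `[φ u, φ v]` are dominated by those of `p ∘ φ`. -/
theorem exists_le_mem_pathSums_comp {M : Type*} [MetricSpace M] {p : ℝ → M} {φ : ℝ → ℝ}
    {α β u v L : ℝ} (hu : α ≤ u) (huv : u ≤ v) (hv : v ≤ β) (hφ : ContinuousOn φ (Set.Icc u v))
    (hL : L ∈ pathSums p (φ u) (φ v)) : ∃ L' ∈ pathSums (p ∘ φ) α β, L ≤ L' := by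
  obtain ⟨n, t, h0, hn, ht, rfl⟩ := hL
  obtain ⟨g, hg, hgφ⟩ := exists_monotoneOn_rightInverse huv hφ
  have hmono : MonotoneOn t (Set.Iic n) :=
    monotoneOn_of_le_add_one Set.ordConnected_Iic fun i _ _ hi => (ht i hi).le
  have hmem : ∀ i ≤ n, t i ∈ Set.Icc (φ u) (φ v) := fun i hi =>
    ⟨h0 ▸ hmono (Nat.zero_le n) hi (Nat.zero_le i), hn ▸ hmono hi (le_refl n) hi⟩
  obtain ⟨L', hL', hle⟩ := exists_sum_dist_le_mem_pathSums (p ∘ φ) (g ∘ t) n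
    (fun i hi => hg (hmem i hi.le) (hmem (i + 1) hi) (ht i hi).le)
    (hu.trans (hgφ _ (hmem 0 n.zero_le)).1.1) ((hgφ _ (hmem n le_rfl)).1.2.trans hv)
  refine ⟨L', hL', le_of_eq_of_le (Finset.sum_congr rfl fun i hi => ?_) hle⟩
  have hi := Finset.mem_range.mp hi
  simp [(hgφ _ (hmem i hi.le)).2, (hgφ _ (hmem (i + 1) hi)).2]

/-- Partition sums are unchanged by reversing the path. -/
theorem mem_pathSums_comp_neg {M : Type*} [MetricSpace M] {p : ℝ → M} {a b L : ℝ}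
    (hL : L ∈ pathSums p a b) : L ∈ pathSums (fun x => p (-x)) (-b) (-a) := by
  obtain ⟨n, t, rfl, rfl, ht, rfl⟩ := hL
  refine ⟨n, fun i => -t (n - i), by simp, by simp, fun i hi => ?_, ?_⟩
  · have := ht (n - (i + 1)) (by lia)
    rw [show n - (i + 1) + 1 = n - i by lia] at this
    exact neg_lt_neg this
  · rw [← Finset.sum_range_reflect]
    refine Finset.sum_congr rfl fun i hi => ?_
    have hi := Finset.mem_range.mp hi
    rw [show n - 1 - i + 1 = n - i by lia, show n - 1 - i = n - (i + 1) by lia, dist_comm]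
    simp

/-- If `φ` is a continuous map of `[α, β]` onto `[a, b]` and `p ∘ φ` has finite
length, then `p` has finite length at most that of `p ∘ φ`. -/
theorem pathLength_le_of_comp_surjective {M : Type*} [MetricSpace M]
    (a b α β : ℝ) (hab : a ≤ b) (hαβ : α ≤ β)
    (p : ℝ → M) (hp : ContinuousOn p (Set.Icc a b))
    (φ : ℝ → ℝ) (hφc : ContinuousOn φ (Set.Icc α β))
    (hφs : φ '' Set.Icc α β = Set.Icc a b)
    (hfin : HasFiniteLength (p ∘ φ) α β) :
    HasFiniteLength p a b ∧ pathLength p a b ≤ pathLength (p ∘ φ) α β := by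
  have key : ∀ L ∈ pathSums p a b, ∃ L' ∈ pathSums (p ∘ φ) α β, L ≤ L' := by
    obtain ⟨u, hu, rfl⟩ : a ∈ φ '' Set.Icc α β := hφs ▸ Set.left_mem_Icc.mpr hab
    obtain ⟨v, hv, rfl⟩ : b ∈ φ '' Set.Icc α β := hφs ▸ Set.right_mem_Icc.mpr hab
    intro L hL
    rcases le_total u v with huv | hvu
    · exact exists_le_mem_pathSums_comp hu.1 huv hv.2
        (hφc.mono (Set.Icc_subset_Icc hu.1 hv.2)) hL
    · have h := exists_le_mem_pathSums_comp (φ := fun x => -φ x) hv.1 hvu hu.2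
        (hφc.mono (Set.Icc_subset_Icc hv.1 hu.2)).neg (mem_pathSums_comp_neg hL)
      simpa [Function.comp_def] using h
  have hle : ∀ L ∈ pathSums p a b, L ≤ pathLength (p ∘ φ) α β := fun L hL =>
    let ⟨_, hL', h⟩ := key L hL
    h.trans (le_csSup hfin hL')
  exact ⟨⟨_, hle⟩, csSup_le (pathSums_nonempty p hab) hle⟩
end

section
/- Let (M, d) be a metric space, let a ≤ b be real numbers, and let p : [a, b] → M be a continuous path of finite length, with Λ(a, r) denoting the length of the restriction of p to [a, r]. Then there exists a map q : [0, Λ(a, b)] → M which is Lipschitz with constant 1 and satisfies q(Λ(a, r)) = p(r) for every r ∈ [a, b]. -/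
open Set

theorem zero_mem_pathSums {M : Type*} [MetricSpace M] (p : ℝ → M) (a : ℝ) :
    (0 : ℝ) ∈ pathSums p a a :=
  ⟨0, fun _ ↦ a, rfl, rfl, by simp, by simp⟩

/-- A partition of `[a, x]` can be prolonged by one further point `y ≥ x`. -/
theorem add_dist_mem_pathSums {M : Type*} [MetricSpace M] {p : ℝ → M} {a x y L : ℝ}
    (hL : L ∈ pathSums p a x) (hxy : x ≤ y) : L + dist (p x) (p y) ∈ pathSums p a y := by
  rcases hxy.eq_or_lt with rfl | hlt
  · simpa using hL
  obtain ⟨n, t, h0, hn, ht, rfl⟩ := hL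
  refine ⟨n + 1, fun i ↦ if i ≤ n then t i else y, by simpa using h0, by simp,
    fun i hi ↦ ?_, ?_⟩
  · rcases (Nat.lt_succ_iff.mp hi).eq_or_lt with rfl | hi
    · simpa [hn] using hlt
    · simpa [hi.le, Nat.succ_le_of_lt hi] using ht i hi
  · rw [Finset.sum_range_succ]
    congr 1
    · refine Finset.sum_congr rfl fun i hi ↦ ?_
      have hi := Finset.mem_range.mp hi
      simp [hi.le, Nat.succ_le_of_lt hi]
    · simp [hn]

/-- The sum along any monotone sequence in `[a, ∞)` is dominated by the sum of a partition. -/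
theorem exists_mem_pathSums_ge {M : Type*} [MetricSpace M] (p : ℝ → M) {a : ℝ} {u : ℕ → ℝ}
    (hu : Monotone u) (ha : a ≤ u 0) (n : ℕ) :
    ∃ L ∈ pathSums p a (u n), ∑ i ∈ Finset.range n, dist (p (u i)) (p (u (i + 1))) ≤ L := by
  induction n with
  | zero => exact ⟨_, add_dist_mem_pathSums (zero_mem_pathSums p a) ha, by simp⟩
  | succ n ih =>
    obtain ⟨L, hL, hle⟩ := ih
    refine ⟨_, add_dist_mem_pathSums hL (hu n.le_succ), ?_⟩
    rw [Finset.sum_range_succ]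
    gcongr

theorem eVariationOn_le_of_mem_upperBounds_pathSums {M : Type*} [MetricSpace M] {p : ℝ → M}
    {a b C : ℝ} (hC : C ∈ upperBounds (pathSums p a b)) :
    eVariationOn p (Icc a b) ≤ ENNReal.ofReal C := by
  refine iSup_le fun ⟨n, u, hu, hmem⟩ ↦ ?_
  obtain ⟨L, hL, hle⟩ := exists_mem_pathSums_ge p hu (hmem 0).1 n
  have hLC := hC (add_dist_mem_pathSums hL (hmem n).2)
  have hd : 0 ≤ dist (p (u n)) (p b) := dist_nonneg
  simp only [edist_dist]
  rw [← ENNReal.ofReal_sum_of_nonneg fun _ _ ↦ dist_nonneg]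
  refine ENNReal.ofReal_le_ofReal ?_
  simp only [dist_comm (p (u (_ + 1)))]
  linarith

theorem HasFiniteLength.boundedVariationOn {M : Type*} [MetricSpace M] {p : ℝ → M} {a b : ℝ}
    (h : HasFiniteLength p a b) : BoundedVariationOn p (Icc a b) := by
  obtain ⟨C, hC⟩ := h
  exact ((eVariationOn_le_of_mem_upperBounds_pathSums hC).trans_lt ENNReal.ofReal_lt_top).ne

theorem pathLength_eq_toReal_eVariationOn {M : Type*} [MetricSpace M] {p : ℝ → M} {a b : ℝ}
    (hab : a ≤ b) (h : BoundedVariationOn p (Icc a b)) :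
    pathLength p a b = (eVariationOn p (Icc a b)).toReal := by
  have hne := add_dist_mem_pathSums (zero_mem_pathSums p a) hab
  refine IsLUB.csSup_eq ⟨?_, fun C hC ↦ ?_⟩ ⟨_, hne⟩
  · rintro _ ⟨n, t, rfl, rfl, ht, rfl⟩
    have hmono : MonotoneOn t (Iic n) :=
      (strictMonoOn_of_lt_add_one ordConnected_Iic fun i _ _ hi ↦ ht i hi).monotoneOn
    have hsum := eVariationOn.sum_le_of_monotoneOn_Iic (f := p) (s := Icc (t 0) (t n)) hmono
      fun i hi ↦ ⟨hmono (Nat.zero_le n) hi (Nat.zero_le i), hmono hi self_mem_Iic hi⟩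
    simp only [edist_dist] at hsum
    rw [← ENNReal.ofReal_sum_of_nonneg fun _ _ ↦ dist_nonneg,
      ENNReal.ofReal_le_iff_le_toReal h] at hsum
    simpa only [dist_comm] using hsum
  · have hC0 : 0 ≤ C := (add_nonneg le_rfl dist_nonneg).trans (hC hne)
    exact ENNReal.toReal_le_of_le_ofReal hC0 (eVariationOn_le_of_mem_upperBounds_pathSums hC)

theorem continuousOn_variationOnFromTo {M : Type*} [PseudoMetricSpace M] {p : ℝ → M} {s : Set ℝ}
    {a : ℝ} (ha : a ∈ s) (hbv : LocallyBoundedVariationOn p s) (hp : ContinuousOn p s) :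
    ContinuousOn (variationOnFromTo p s a) s := by
  intro x hx
  have hl := variationOnFromTo.tendsto_left ha hx hbv
    ((hp x hx).mono_left (nhdsWithin_mono x inter_subset_left))
  have hr := variationOnFromTo.tendsto_right ha hx hbv
    ((hp x hx).mono_left (nhdsWithin_mono x inter_subset_left))
  rw [dist_self, sub_zero] at hl
  rw [dist_self, add_zero] at hr
  rw [← continuousWithinAt_sdiff_self]
  have hs : s \ {x} = s ∩ Iio x ∪ s ∩ Ioi x := by
    rw [← inter_union_distrib_left, Iio_union_Ioi, sdiff_eq]
  rw [hs, continuousWithinAt_union]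
  exact ⟨hl, hr⟩

theorem dist_le_abs_variationOnFromTo_sub {M : Type*} [PseudoMetricSpace M] {p : ℝ → M}
    {s : Set ℝ} {a x y : ℝ} (hbv : LocallyBoundedVariationOn p s) (ha : a ∈ s) (hx : x ∈ s)
    (hy : y ∈ s) :
    dist (p x) (p y) ≤ |variationOnFromTo p s a x - variationOnFromTo p s a y| := by
  wlog hxy : x ≤ y generalizing x y
  · rw [dist_comm, abs_sub_comm]
    exact this hy hx (le_of_not_ge hxy)
  rw [abs_sub_comm, variationOnFromTo.sub_right hbv ha hy hx, variationOnFromTo.eq_of_le _ _ hxy]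
  exact ((hbv x y hx hy).dist_le ⟨hx, le_rfl, hxy⟩ ⟨hy, hxy, le_rfl⟩).trans (le_abs_self _)

/-- A continuous path of finite length admits a `1`-Lipschitz reparametrization
by arclength. -/
theorem exists_arclength_reparametrization {M : Type*} [MetricSpace M] (a b : ℝ)
    (hab : a ≤ b) (p : ℝ → M) (hp : ContinuousOn p (Set.Icc a b))
    (hfin : HasFiniteLength p a b) :
    ∃ q : ℝ → M,
      (∀ s ∈ Set.Icc (0 : ℝ) (pathLength p a b), ∀ t ∈ Set.Icc (0 : ℝ) (pathLength p a b),
        dist (q s) (q t) ≤ |s - t|) ∧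
      ∀ r ∈ Set.Icc a b, q (pathLength p a r) = p r := by
  have hbv := hfin.boundedVariationOn
  have hlbv := hbv.locallyBoundedVariationOn
  have ha : a ∈ Icc a b := left_mem_Icc.mpr hab
  set V := variationOnFromTo p (Icc a b) a with hV
  have hlen : ∀ r ∈ Icc a b, pathLength p a r = V r := fun r hr ↦ by
    have hsub : Icc a r ⊆ Icc a b := Icc_subset_Icc_right hr.2
    rw [pathLength_eq_toReal_eVariationOn hr.1 (hbv.mono hsub), hV,
      variationOnFromTo.eq_of_le _ _ hr.1, inter_eq_right.mpr hsub]
  have hsurj : SurjOn V (Icc a b) (Icc 0 (pathLength p a b)) := by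
    have hivt := intermediate_value_Icc hab (continuousOn_variationOnFromTo ha hlbv hp)
    rwa [variationOnFromTo.self, ← hV, ← hlen b (right_mem_Icc.mpr hab)] at hivt
  have hdist : ∀ x ∈ Icc a b, ∀ y ∈ Icc a b, dist (p x) (p y) ≤ |V x - V y| :=
    fun x hx y hy ↦ dist_le_abs_variationOnFromTo_sub hlbv ha hx hy
  refine ⟨p ∘ Function.invFunOn V (Icc a b), fun s hs t ht ↦ ?_, fun r hr ↦ ?_⟩
  · have h := hdist _ (Function.invFunOn_mem (hsurj hs)) _ (Function.invFunOn_mem (hsurj ht))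
    rwa [Function.invFunOn_eq (hsurj hs), Function.invFunOn_eq (hsurj ht)] at h
  · have himg : ∃ x ∈ Icc a b, V x = V r := ⟨r, hr, rfl⟩
    have h := hdist _ (Function.invFunOn_mem himg) r hr
    rw [Function.invFunOn_eq himg, sub_self, abs_zero] at h
    rw [hlen r hr]
    exact dist_le_zero.mp h
end

section
/- Let n ≥ 1, let a ≤ b be real numbers, and let p : [a, b] → ℝⁿ be a continuous path (with respect to the Euclidean metric) whose image lies in the unit sphere, i.e., ‖p(t)‖ = 1 for all t ∈ [a, b]. If p has finite length Λ with respect to the Euclidean metric, then Λ ≥ 2·arcsin(‖p(a) − p(b)‖/2); that is, the Euclidean length of any path in the unit sphere is at least the spherical distance between its endpoints. -/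
open InnerProductGeometry in
/-- The chord between unit vectors at angle `θ` has length `2 sin (θ / 2)`. -/
theorem norm_sub_eq_two_mul_sin_half_angle {V : Type*} [NormedAddCommGroup V]
    [InnerProductSpace ℝ V] {x y : V} (hx : ‖x‖ = 1) (hy : ‖y‖ = 1) :
    ‖x - y‖ = 2 * Real.sin (angle x y / 2) := by
  have hsin : 0 ≤ Real.sin (angle x y / 2) :=
    Real.sin_nonneg_of_nonneg_of_le_pi (by linarith [angle_nonneg x y])
      (by linarith [angle_le_pi x y, angle_nonneg x y])
  refine (sq_eq_sq₀ (norm_nonneg _) (by positivity)).1 ?_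
  have hinner := (cos_angle_mul_norm_mul_norm x y).symm
  have hcos := Real.cos_sq' (angle x y / 2)
  have hdouble := Real.cos_two_mul (angle x y / 2)
  rw [mul_div_cancel₀ _ (two_ne_zero' ℝ)] at hdouble
  rw [norm_sub_sq_real, hinner, hx, hy, hdouble, hcos]
  ring

open InnerProductGeometry in
theorem angle_eq_two_mul_arcsin {V : Type*} [NormedAddCommGroup V]
    [InnerProductSpace ℝ V] {x y : V} (hx : ‖x‖ = 1) (hy : ‖y‖ = 1) :
    angle x y = 2 * Real.arcsin (‖x - y‖ / 2) := by
  rw [norm_sub_eq_two_mul_sin_half_angle hx hy, mul_div_cancel_left₀ _ (two_ne_zero' ℝ),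
    Real.arcsin_sin (by linarith [angle_nonneg x y, Real.pi_pos])
      (by linarith [angle_le_pi x y])]
  ring

theorem Real.mul_cos_le_sin {x : ℝ} (h₀ : 0 ≤ x) (h₁ : x ≤ Real.pi / 2) :
    x * Real.cos x ≤ Real.sin x := by
  rcases h₁.eq_or_lt with rfl | h
  · simp
  · have hcos : 0 < Real.cos x :=
      Real.cos_pos_of_mem_Ioo ⟨by linarith [Real.pi_pos], h⟩
    have htan := Real.le_tan h₀ h
    rwa [Real.tan_eq_sin_div_cos, le_div_iff₀ hcos] at htan

open InnerProductGeometry in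
/-- Short chords of the unit sphere are almost as long as the arcs they subtend. -/
theorem one_sub_mul_angle_le_dist {V : Type*} [NormedAddCommGroup V]
    [InnerProductSpace ℝ V] {x y : V} (hx : ‖x‖ = 1) (hy : ‖y‖ = 1) {ε : ℝ}
    (hε : ε ≤ 1) (hxy : dist x y ≤ ε) : (1 - ε) * angle x y ≤ dist x y := by
  have hd : 0 ≤ dist x y := dist_nonneg
  have hchord := norm_sub_eq_two_mul_sin_half_angle hx hy
  rw [← dist_eq_norm] at hchord
  have h₀ := angle_nonneg x y
  have hpi := angle_le_pi x y
  have hcos₀ : 0 ≤ Real.cos (angle x y / 2) :=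
    Real.cos_nonneg_of_mem_Icc ⟨by linarith [Real.pi_pos], by linarith⟩
  have hcos : 1 - ε ≤ Real.cos (angle x y / 2) := by
    have hsq := Real.sin_sq_add_cos_sq (angle x y / 2)
    nlinarith [Real.cos_le_one (angle x y / 2)]
  have hmul := Real.mul_cos_le_sin (x := angle x y / 2) (by linarith) (by linarith)
  nlinarith

open InnerProductGeometry in
theorem angle_le_sum_range_angle {V : Type*} [NormedAddCommGroup V]
    [InnerProductSpace ℝ V] (x : ℕ → V) (hx : x 0 ≠ 0) (n : ℕ) :
    angle (x 0) (x n) ≤ ∑ i ∈ Finset.range n, angle (x i) (x (i + 1)) := by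
  induction n with
  | zero => simp [angle_self hx]
  | succ k ih =>
    rw [Finset.sum_range_succ]
    linarith [angle_le_angle_add_angle (x 0) (x k) (x (k + 1))]

/-- A continuous path on a compact interval admits partitions whose consecutive points have
images within any prescribed positive distance. -/
theorem exists_partition_dist_le {M : Type*} [MetricSpace M] {p : ℝ → M} {a b : ℝ}
    (hab : a ≤ b) (hp : ContinuousOn p (Set.Icc a b)) {ε : ℝ} (hε : 0 < ε) :
    ∃ (n : ℕ) (t : ℕ → ℝ), t 0 = a ∧ t n = b ∧ (∀ i < n, t i < t (i + 1)) ∧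
      (∀ i ≤ n, t i ∈ Set.Icc a b) ∧ ∀ i < n, dist (p (t i)) (p (t (i + 1))) ≤ ε := by
  rcases hab.eq_or_lt with rfl | hlt
  · exact ⟨0, fun _ => a, rfl, rfl, by simp, by simp, by simp⟩
  obtain ⟨δ, hδ, hunif⟩ := Metric.uniformContinuousOn_iff.1
    (isCompact_Icc.uniformContinuousOn_of_continuous hp) ε hε
  obtain ⟨N, hN⟩ := exists_nat_gt ((b - a) / δ)
  have hN₀ : (0 : ℝ) < N := lt_of_le_of_lt (div_nonneg (by linarith) hδ.le) hN
  set s := (b - a) / N with hs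
  have hs₀ : 0 < s := div_pos (by linarith) hN₀
  have hNs : N * s = b - a := by rw [hs]; field_simp
  have hsδ : s < δ := by
    rw [div_lt_iff₀ hδ] at hN
    rw [hs, div_lt_iff₀ hN₀]
    linarith
  have hmem : ∀ i ≤ N, a + i * s ∈ Set.Icc a b := fun i hi => by
    have hi' : (i : ℝ) ≤ N := by exact_mod_cast hi
    have hle := mul_le_mul_of_nonneg_right hi' hs₀.le
    exact ⟨by linarith [mul_nonneg i.cast_nonneg hs₀.le], by linarith⟩
  refine ⟨N, fun i => a + i * s, by simp, by simp only []; linarith, fun i _ => ?_, hmem,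
    fun i hi => (hunif _ (hmem i hi.le) _ (hmem (i + 1) hi) ?_).le⟩
  · push_cast
    linarith
  · rw [Real.dist_eq, abs_sub_lt_iff]
    push_cast
    constructor <;> linarith

/-- The Euclidean length of a path in the unit sphere is at least the spherical
distance between its endpoints. -/
theorem spherical_dist_le_pathLength (n : ℕ) (hn : 1 ≤ n) (a b : ℝ) (hab : a ≤ b)
    (p : ℝ → EuclideanSpace ℝ (Fin n)) (hp : ContinuousOn p (Set.Icc a b))
    (hsphere : ∀ t ∈ Set.Icc a b, ‖p t‖ = 1) (hfin : HasFiniteLength p a b) :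
    2 * Real.arcsin (‖p a - p b‖ / 2) ≤ pathLength p a b := by
  have ha := hsphere a (Set.left_mem_Icc.2 hab)
  rw [← angle_eq_two_mul_arcsin ha (hsphere b (Set.right_mem_Icc.2 hab))]
  set A := InnerProductGeometry.angle (p a) (p b)
  have hbound : ∀ ε ∈ Set.Ioo (0 : ℝ) 1, (1 - ε) * A ≤ pathLength p a b := by
    rintro ε ⟨hε₀, hε₁⟩
    obtain ⟨N, t, ht₀, htN, hmono, hmem, hdist⟩ := exists_partition_dist_le hab hp hε₀
    have hpt : p (t 0) ≠ 0 := by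
      rw [ht₀]
      exact norm_ne_zero_iff.1 (by simp [ha])
    have hangle := angle_le_sum_range_angle (fun i => p (t i)) hpt N
    simp only [ht₀, htN] at hangle
    calc (1 - ε) * A
        ≤ (1 - ε) * ∑ i ∈ Finset.range N,
            InnerProductGeometry.angle (p (t i)) (p (t (i + 1))) :=
          mul_le_mul_of_nonneg_left hangle (by linarith)
      _ ≤ ∑ i ∈ Finset.range N, dist (p (t i)) (p (t (i + 1))) := by
          rw [Finset.mul_sum]
          refine Finset.sum_le_sum fun i hi => ?_
          have hi := Finset.mem_range.1 hi
          exact one_sub_mul_angle_le_dist (hsphere _ (hmem i hi.le))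
            (hsphere _ (hmem (i + 1) hi)) hε₁.le (hdist i hi)
      _ ≤ pathLength p a b := le_csSup hfin ⟨N, t, ht₀, htN, hmono, rfl⟩
  have hlim : Filter.Tendsto (fun ε : ℝ => (1 - ε) * A) (nhdsWithin 0 (Set.Ioi 0))
      (nhds A) := by
    have hcont : Continuous fun ε : ℝ => (1 - ε) * A := by fun_prop
    simpa using (hcont.tendsto 0).mono_left nhdsWithin_le_nhds
  exact le_of_tendsto hlim
    (Filter.mem_of_superset (Ioo_mem_nhdsGT one_pos) hbound)
end

section
/- Let n ≥ 1, let a ≤ b be real numbers, and let p : [a, b] → ℝⁿ be a continuous path whose image lies in the unit sphere, i.e., ‖p(t)‖ = 1 for all t ∈ [a, b]. Then p has finite length with respect to the Euclidean metric d_E(x, y) = ‖x − y‖ if and only if it has finite length with respect to the spherical metric d_S(x, y) = 2·arcsin(‖x − y‖/2), and in that case the two lengths are equal: the supremum over all partitions a = t₀ < ⋯ < tₙ = b of Σ_{j=1}^n ‖p(t_j) − p(t_{j−1})‖ equals the supremum over all partitions of Σ_{j=1}^n 2·arcsin(‖p(t_j) − p(t_{j−1})‖/2). -/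
/-- The approximations to the length of a path in the unit sphere using the
spherical metric `d_S(x, y) = 2 * arcsin (‖x - y‖ / 2)`. -/
def sphericalPathSums {n : ℕ} (p : ℝ → EuclideanSpace ℝ (Fin n)) (a b : ℝ) : Set ℝ :=
  {L | ∃ (m : ℕ) (t : ℕ → ℝ), t 0 = a ∧ t m = b ∧ (∀ i < m, t i < t (i + 1)) ∧
        L = ∑ i ∈ Finset.range m,
              2 * Real.arcsin (‖p (t i) - p (t (i + 1))‖ / 2)}

open Real Set

/-- The angle between unit vectors is twice the arcsine of half the chord. -/
lemma two_mul_arcsin_half_norm_sub_eq_angle {E : Type*} [NormedAddCommGroup E]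
    [InnerProductSpace ℝ E] {x y : E} (hx : ‖x‖ = 1) (hy : ‖y‖ = 1) :
    2 * arcsin (‖x - y‖ / 2) = InnerProductGeometry.angle x y := by
  set θ := InnerProductGeometry.angle x y with hθ
  have h0 : 0 ≤ θ := InnerProductGeometry.angle_nonneg x y
  have hpi : θ ≤ π := InnerProductGeometry.angle_le_pi x y
  have hsin : 0 ≤ sin (θ / 2) := sin_nonneg_of_nonneg_of_le_pi (by linarith) (by linarith)
  have hcos : cos θ = 1 - 2 * sin (θ / 2) ^ 2 := by
    have h := cos_two_mul (θ / 2)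
    rw [mul_div_cancel₀ θ two_ne_zero] at h
    linarith [sin_sq_add_cos_sq (θ / 2)]
  have hinner : inner ℝ x y = cos θ := by
    rw [hθ, InnerProductGeometry.cos_angle, hx, hy]
    simp
  have hnorm : ‖x - y‖ = 2 * sin (θ / 2) := by
    have h := norm_sub_sq_real x y
    rw [hx, hy, hinner, hcos] at h
    exact (sq_eq_sq₀ (norm_nonneg _) (by positivity)).1 (by linarith)
  rw [hnorm, mul_div_cancel_left₀ _ two_ne_zero, arcsin_sin (by linarith) (by linarith)]
  ring

/-- On the unit sphere the Euclidean distance is at most the spherical distance. -/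
lemma norm_sub_le_two_mul_arcsin {E : Type*} [NormedAddCommGroup E]
    {x y : E} (hx : ‖x‖ = 1) (hy : ‖y‖ = 1) :
    ‖x - y‖ ≤ 2 * arcsin (‖x - y‖ / 2) := by
  have hle : ‖x - y‖ / 2 ≤ 1 := by linarith [norm_sub_le x y]
  have hnonneg : 0 ≤ ‖x - y‖ / 2 := by positivity
  have h := sin_le (arcsin_nonneg.2 hnonneg)
  rw [sin_arcsin (by linarith) hle] at h
  linarith

lemma exists_two_mul_arcsin_half_le {ε : ℝ} (hε : 0 < ε) :
    ∃ δ > 0, ∀ u : ℝ, 0 ≤ u → u < δ → 2 * arcsin (u / 2) ≤ (1 + ε) * u := by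
  have hderiv : HasDerivAt arcsin 1 0 := by
    simpa using hasDerivAt_arcsin (x := 0) (by norm_num) (by norm_num)
  have h := (hasDerivAt_iff_isLittleO.1 hderiv).def hε
  obtain ⟨δ, hδ, hδ'⟩ := Metric.eventually_nhds_iff.1 h
  refine ⟨δ, hδ, fun u hu hlt => ?_⟩
  have hbound := @hδ' (u / 2) (by
    rw [Real.dist_eq, sub_zero, abs_of_nonneg (by positivity)]
    linarith)
  simp only [arcsin_zero, sub_zero, smul_eq_mul, mul_one, Real.norm_eq_abs] at hbound
  rw [abs_of_nonneg (by positivity : 0 ≤ u / 2)] at hbound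
  linarith [le_abs_self (arcsin (u / 2) - u / 2)]

lemma dist_mem_pathSums {M : Type*} [MetricSpace M] (p : ℝ → M) {x y : ℝ} (hxy : x < y) :
    dist (p x) (p y) ∈ pathSums p x y :=
  ⟨1, fun i => if i = 0 then x else y, by simp, by simp, by simpa using hxy, by simp⟩

lemma zero_mem_pathSums_self {M : Type*} [MetricSpace M] (p : ℝ → M) (x : ℝ) :
    0 ∈ pathSums p x x :=
  ⟨0, fun _ => x, rfl, rfl, by simp, by simp⟩

/-- Concatenating partitions adds the corresponding approximations. -/
lemma add_mem_pathSums {M : Type*} [MetricSpace M] {p : ℝ → M} {x y z K L : ℝ}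
    (hK : K ∈ pathSums p x y) (hL : L ∈ pathSums p y z) : K + L ∈ pathSums p x z := by
  obtain ⟨m, s, hs0, hsm, hs, rfl⟩ := hK
  obtain ⟨n, t, ht0, htn, ht, rfl⟩ := hL
  set u : ℕ → ℝ := fun i => if i < m then s i else t (i - m)
  have hleft : ∀ i ≤ m, u i = s i := by
    intro i hi
    rcases hi.lt_or_eq with hi | rfl
    · simp [u, hi]
    · simp [u, ht0, hsm]
  have hright : ∀ i, u (m + i) = t i := fun i => by simp [u]
  refine ⟨m + n, u, by rw [hleft 0 (Nat.zero_le m), hs0], by rw [hright, htn], ?_, ?_⟩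
  · intro i hi
    rcases lt_or_ge i m with him | him
    · rw [hleft i him.le, hleft (i + 1) him]
      exact hs i him
    · obtain ⟨k, rfl⟩ := Nat.exists_eq_add_of_le him
      rw [add_assoc, hright, hright]
      exact ht k (by omega)
  · rw [Finset.sum_range_add]
    congr 1
    · refine Finset.sum_congr rfl fun i hi => ?_
      have him := Finset.mem_range.1 hi
      rw [hleft i him.le, hleft (i + 1) him]
    · refine Finset.sum_congr rfl fun i _ => ?_
      rw [add_assoc, hright, hright]

lemma partition_mem_Icc {a b : ℝ} {m : ℕ} {t : ℕ → ℝ} (h0 : t 0 = a) (hm : t m = b)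
    (ht : ∀ i < m, t i < t (i + 1)) {i : ℕ} (hi : i ≤ m) : t i ∈ Icc a b := by
  have hmono : MonotoneOn t (Icc 0 m) :=
    monotoneOn_of_le_add_one ordConnected_Icc fun i _ _ hi' => (ht i hi'.2).le
  have hmem : ∀ {j}, j ≤ m → j ∈ Icc 0 m := fun hj => ⟨Nat.zero_le _, hj⟩
  exact ⟨h0 ▸ hmono (hmem (Nat.zero_le m)) (hmem hi) (Nat.zero_le i),
    hm ▸ hmono (hmem hi) (hmem le_rfl) hi⟩

/-- If `d` satisfies the triangle inequality along a continuous path and is at most `c` times the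
distance at small scales, then it is at most `c` times some approximation to the length. -/
lemma exists_mem_pathSums_le_mul {M : Type*} [MetricSpace M] {p : ℝ → M} {a b c δ : ℝ}
    (hp : ContinuousOn p (Icc a b)) (d : M → M → ℝ)
    (htri : ∀ x ∈ Icc a b, ∀ y ∈ Icc a b, ∀ z ∈ Icc a b,
      d (p x) (p z) ≤ d (p x) (p y) + d (p y) (p z))
    (hδ : 0 < δ) (hd : ∀ x y, dist x y < δ → d x y ≤ c * dist x y)
    {x y : ℝ} (hx : x ∈ Icc a b) (hy : y ∈ Icc a b) (hxy : x < y) :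
    ∃ L ∈ pathSums p x y, d (p x) (p y) ≤ c * L := by
  obtain ⟨η, hη, hunif⟩ := Metric.uniformContinuousOn_iff.1
    (isCompact_Icc.uniformContinuousOn_of_continuous hp) δ hδ
  have hscale : ∀ k : ℕ, ∀ x ∈ Icc a b, ∀ y ∈ Icc a b, x < y → y - x < 2 ^ k * η →
      ∃ L ∈ pathSums p x y, d (p x) (p y) ≤ c * L := by
    intro k
    induction k with
    | zero =>
      intro x hx y hy hxy hlt
      refine ⟨_, dist_mem_pathSums p hxy, hd _ _ (hunif x hx y hy ?_)⟩
      rw [dist_comm, Real.dist_eq, abs_of_pos (sub_pos.2 hxy)]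
      simpa using hlt
    | succ k ih =>
      intro x hx y hy hxy hlt
      rw [pow_succ] at hlt
      have hmid : (x + y) / 2 ∈ Icc a b := ⟨by linarith [hx.1, hy.1], by linarith [hx.2, hy.2]⟩
      obtain ⟨K, hK, hKle⟩ := ih x hx _ hmid (by linarith) (by linarith)
      obtain ⟨L, hL, hLle⟩ := ih _ hmid y hy (by linarith) (by linarith)
      refine ⟨K + L, add_mem_pathSums hK hL, ?_⟩
      linarith [htri x hx _ hmid y hy]
  obtain ⟨k, hk⟩ := pow_unbounded_of_one_lt ((y - x) / η) one_lt_two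
  exact hscale k x hx y hy hxy ((div_lt_iff₀ hη).1 hk)

/-- Every spherical approximation is at most `1 + ε` times some Euclidean approximation. -/
lemma exists_mem_pathSums_of_mem_sphericalPathSums {n : ℕ} {a b ε S : ℝ} (hε : 0 < ε)
    {p : ℝ → EuclideanSpace ℝ (Fin n)} (hp : ContinuousOn p (Icc a b))
    (hsphere : ∀ t ∈ Icc a b, ‖p t‖ = 1) (hS : S ∈ sphericalPathSums p a b) :
    ∃ L ∈ pathSums p a b, S ≤ (1 + ε) * L := by
  obtain ⟨m, t, h0, hm, ht, rfl⟩ := hS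
  obtain ⟨δ, hδ, harcsin⟩ := exists_two_mul_arcsin_half_le hε
  have hpiece : ∀ i < m, ∃ L ∈ pathSums p (t i) (t (i + 1)),
      2 * arcsin (‖p (t i) - p (t (i + 1))‖ / 2) ≤ (1 + ε) * L := by
    intro i hi
    refine exists_mem_pathSums_le_mul hp (fun u v => 2 * arcsin (‖u - v‖ / 2)) ?_ hδ ?_
      (partition_mem_Icc h0 hm ht hi.le) (partition_mem_Icc h0 hm ht hi) (ht i hi)
    · intro x hx y hy z hz
      simp only [two_mul_arcsin_half_norm_sub_eq_angle, hsphere x hx, hsphere y hy, hsphere z hz]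
      exact InnerProductGeometry.angle_le_angle_add_angle _ _ _
    · intro u v huv
      rw [dist_eq_norm] at huv ⊢
      exact harcsin _ (norm_nonneg _) huv
  have hprefix : ∀ k ≤ m, ∃ L ∈ pathSums p a (t k),
      ∑ i ∈ Finset.range k, 2 * arcsin (‖p (t i) - p (t (i + 1))‖ / 2) ≤ (1 + ε) * L := by
    intro k
    induction k with
    | zero => exact fun _ => ⟨0, h0 ▸ zero_mem_pathSums_self p _, by simp⟩
    | succ k ih =>
      intro hk
      obtain ⟨K, hK, hKle⟩ := ih (by omega)
      obtain ⟨L, hL, hLle⟩ := hpiece k hk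
      refine ⟨K + L, add_mem_pathSums hK hL, ?_⟩
      rw [Finset.sum_range_succ]
      linarith
  exact hm ▸ hprefix m le_rfl

/-- The Euclidean and the spherical approximations have the same upper bounds. -/
lemma upperBounds_pathSums_eq {n : ℕ} {a b : ℝ}
    {p : ℝ → EuclideanSpace ℝ (Fin n)} (hp : ContinuousOn p (Icc a b))
    (hsphere : ∀ t ∈ Icc a b, ‖p t‖ = 1) :
    upperBounds (pathSums p a b) = upperBounds (sphericalPathSums p a b) := by
  ext C
  constructor
  · intro hC S hS
    have hbound : ∀ ε > 0, S ≤ (1 + ε) * C := by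
      intro ε hε
      obtain ⟨L, hL, hSL⟩ := exists_mem_pathSums_of_mem_sphericalPathSums hε hp hsphere hS
      exact hSL.trans (mul_le_mul_of_nonneg_left (hC hL) (by positivity))
    have hlim : Filter.Tendsto (fun ε : ℝ => (1 + ε) * C) (nhdsWithin 0 (Ioi 0)) (nhds C) := by
      have h : Continuous fun ε : ℝ => (1 + ε) * C := by fun_prop
      simpa using (h.tendsto 0).mono_left nhdsWithin_le_nhds
    exact ge_of_tendsto hlim (eventually_mem_nhdsWithin.mono hbound)
  · rintro hC _ ⟨m, t, h0, hm, ht, rfl⟩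
    refine le_trans (Finset.sum_le_sum fun i hi => ?_) (hC ⟨m, t, h0, hm, ht, rfl⟩)
    have him := Finset.mem_range.1 hi
    rw [dist_eq_norm]
    exact norm_sub_le_two_mul_arcsin (hsphere _ (partition_mem_Icc h0 hm ht him.le))
      (hsphere _ (partition_mem_Icc h0 hm ht him))

/-- A path in the unit sphere has finite Euclidean length iff it has finite
spherical length, and then the two lengths coincide. -/
theorem euclidean_length_eq_spherical_length (n : ℕ) (hn : 1 ≤ n) (a b : ℝ)
    (hab : a ≤ b) (p : ℝ → EuclideanSpace ℝ (Fin n))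
    (hp : ContinuousOn p (Set.Icc a b)) (hsphere : ∀ t ∈ Set.Icc a b, ‖p t‖ = 1) :
    (HasFiniteLength p a b ↔ BddAbove (sphericalPathSums p a b)) ∧
      (HasFiniteLength p a b →
        pathLength p a b = sSup (sphericalPathSums p a b)) := by
  have hub := upperBounds_pathSums_eq hp hsphere
  refine ⟨by rw [HasFiniteLength, BddAbove, BddAbove, hub], fun hfin => ?_⟩
  have hne : (pathSums p a b).Nonempty := by
    rcases hab.eq_or_lt with rfl | hlt
    · exact ⟨_, zero_mem_pathSums_self p a⟩
    · exact ⟨_, dist_mem_pathSums p hlt⟩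
  have hne' : (sphericalPathSums p a b).Nonempty := by
    obtain ⟨_, m, t, h0, hm, ht, -⟩ := hne
    exact ⟨_, m, t, h0, hm, ht, rfl⟩
  have hlub : IsLUB (sphericalPathSums p a b) (pathLength p a b) := by
    rw [IsLUB, ← hub]
    exact isLUB_csSup hne hfin
  exact (hlub.csSup_eq hne').symm
end
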